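/- arXiv:2109.00318 — 2 statements merged into one kernel-verified Lean document; each statement's English description precedes it below -/
import Mathlib

section
/- (SP satisfies Proportionality.) Let r be a real number with 0 < r ≤ 1, let cs be a nonempty list of admissible weighted argument trees, let cs' be a list of admissible weighted argument trees, and suppose there is an injective function φ from the index set Fin cs.length into Fin cs'.length such that Str_sp (cs.get i) > Str_sp (cs'.get (φ i)) for every index i. Then Str_sp (node r cs) > Str_sp (node r cs'). -/
/-- A weighted argument tree: a leaf states a premise with a weight,
a node applies an inference rule with a weight to a list of antecedent trees. -/
inductive T where
  | leaf : ℝ → T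
  | node : ℝ → List T → T

/-- The multiset of all weights occurring in a tree. -/
def basis : T → Multiset ℝ
  | .leaf w => {w}
  | .node r cs => r ::ₘ (cs.attach.map (fun c => basis c.1)).sum
decreasing_by
  have := List.sizeOf_lt_of_mem c.2
  simp only [T.node.sizeOf_spec]
  omega

/-- A tree is admissible if every weight in its basis lies in [0,1]. -/
def admissible (A : T) : Prop := ∀ b ∈ basis A, b ∈ Set.Icc (0:ℝ) 1

/-- Simple product method: the product of all weights in the basis (with multiplicity). -/
noncomputable def Str_sp (A : T) : ℝ := (basis A).prod

/-- Weakest link method: the minimum of the weights in the basis. -/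
noncomputable def Str_wl (A : T) : ℝ := sInf {x | x ∈ basis A}

theorem Str_sp_node (r : ℝ) (cs : List T) :
    Str_sp (T.node r cs) = r * ∏ i : Fin cs.length, Str_sp (cs.get i) := by
  have hprod (l : List (Multiset ℝ)) : l.sum.prod = (l.map Multiset.prod).prod := by
    induction l with
    | nil => simp
    | cons a l ih => simp [ih]
  have hattach : cs.attach.map (fun c => basis c.1) = cs.map basis :=
    List.attach_map_val (f := basis)
  rw [Str_sp, basis, Multiset.prod_cons, hattach, hprod, List.map_map, ← List.prod_ofFn]
  congr 2
  conv_lhs => rw [← List.ofFn_get cs, List.map_ofFn]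
  rfl

theorem admissible.Str_sp_nonneg {A : T} (h : admissible A) : 0 ≤ Str_sp A :=
  Multiset.prod_nonneg fun b hb => (h b hb).1

theorem admissible.Str_sp_le_one {A : T} (h : admissible A) : Str_sp A ≤ 1 := by
  have hprod (s : Multiset ℝ) (hs : ∀ b ∈ s, b ∈ Set.Icc (0 : ℝ) 1) : s.prod ≤ 1 := by
    induction s using Multiset.induction with
    | empty => simp
    | cons a s ih =>
      rw [Multiset.forall_mem_cons] at hs
      rw [Multiset.prod_cons]
      exact mul_le_one₀ hs.1.2 (Multiset.prod_nonneg fun b hb => (hs.2 b hb).1) (ih hs.2)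
  exact hprod _ h

/-- A strict comparison of nonempty products of nonnegative factors, where the smaller product may
vanish. -/
theorem Finset.prod_lt_prod_of_nonneg {ι : Type*} {s : Finset ι} {f g : ι → ℝ}
    (hs : s.Nonempty) (hf : ∀ i ∈ s, 0 ≤ f i) (hfg : ∀ i ∈ s, f i < g i) :
    ∏ i ∈ s, f i < ∏ i ∈ s, g i := by
  by_cases hzero : ∃ i ∈ s, f i = 0
  · obtain ⟨i, hi, hfi⟩ := hzero
    rw [Finset.prod_eq_zero hi hfi]
    exact Finset.prod_pos fun j hj => (hf j hj).trans_lt (hfg j hj)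
  · push Not at hzero
    exact Finset.prod_lt_prod_of_nonempty (fun i hi => (hf i hi).lt_of_ne' (hzero i hi)) hfg hs

/-- Dropping factors from a product of numbers in the unit interval does not decrease it. -/
theorem Finset.prod_univ_le_prod_comp_of_injective {ι κ : Type*} [Fintype ι] [Fintype κ]
    {φ : ι → κ} (hφ : Function.Injective φ) {f : κ → ℝ} (h0 : ∀ j, 0 ≤ f j) (h1 : ∀ j, f j ≤ 1) :
    ∏ j, f j ≤ ∏ i, f (φ i) := by
  classical
  rw [← Finset.prod_image (s := Finset.univ) (g := φ) (f := f) hφ.injOn,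
    ← Finset.prod_mul_prod_compl (Finset.univ.image φ) f]
  exact mul_le_of_le_one_right (Finset.prod_nonneg fun j _ => h0 j)
    (Finset.prod_le_one (fun j _ => h0 j) fun j _ => h1 j)

theorem sp_proportionality (r : ℝ) (hr0 : 0 < r) (hr1 : r ≤ 1)
    (cs cs' : List T) (hne : cs ≠ [])
    (hadm : ∀ C ∈ cs, admissible C) (hadm' : ∀ C ∈ cs', admissible C)
    (φ : Fin cs.length → Fin cs'.length) (hinj : Function.Injective φ)
    (hlt : ∀ i : Fin cs.length, Str_sp (cs'.get (φ i)) < Str_sp (cs.get i)) :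
    Str_sp (T.node r cs') < Str_sp (T.node r cs) := by
  have hadm_get (j : Fin cs'.length) : admissible (cs'.get j) := hadm' _ (List.get_mem cs' j)
  have hlen : (Finset.univ : Finset (Fin cs.length)).Nonempty :=
    ⟨⟨0, List.length_pos_of_ne_nil hne⟩, Finset.mem_univ _⟩
  rw [Str_sp_node, Str_sp_node]
  refine mul_lt_mul_of_pos_left ?_ hr0
  calc ∏ j, Str_sp (cs'.get j)
      ≤ ∏ i, Str_sp (cs'.get (φ i)) :=
        Finset.prod_univ_le_prod_comp_of_injective hinj (fun j => (hadm_get j).Str_sp_nonneg)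
          fun j => (hadm_get j).Str_sp_le_one
    _ < ∏ i, Str_sp (cs.get i) :=
        Finset.prod_lt_prod_of_nonneg hlen (fun i _ => (hadm_get (φ i)).Str_sp_nonneg)
          fun i _ => hlt i
end

section
/- (Well-behaved aggregation methods satisfy Argument Death.) Let (f,g) be a well-behaved aggregation method and let A be an admissible weighted argument tree such that 0 is an element of basis A. Then Str_{f,g} A = 0. -/
/-- The (f,g)-strength of a weighted argument tree: g aggregates the strengths of
the antecedents and f combines the rule/premise weight with that aggregate. -/
def Str (f : ℝ → ℝ → ℝ) (g : List ℝ → ℝ) : T → ℝ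
  | .leaf w => f w (g [])
  | .node r cs => f r (g (cs.attach.map (fun c => Str f g c.1)))
decreasing_by
  have := List.sizeOf_lt_of_mem c.2
  simp only [T.node.sizeOf_spec]
  omega

/-- A well-behaved aggregation method. -/
structure WellBehaved (f : ℝ → ℝ → ℝ) (g : List ℝ → ℝ) : Prop where
  f_mem : ∀ x ∈ Set.Icc (0:ℝ) 1, ∀ y ∈ Set.Icc (0:ℝ) 1, f x y ∈ Set.Icc (0:ℝ) 1
  g_mem : ∀ l : List ℝ, (∀ x ∈ l, x ∈ Set.Icc (0:ℝ) 1) → g l ∈ Set.Icc (0:ℝ) 1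
  g_perm : ∀ l l' : List ℝ, l.Perm l' → g l = g l'
  f_mono_left : ∀ x x' y : ℝ, x ∈ Set.Icc (0:ℝ) 1 → x' ∈ Set.Icc (0:ℝ) 1 →
    y ∈ Set.Icc (0:ℝ) 1 → x ≠ 0 → y ≠ 0 → x ≤ x' → f x y ≤ f x' y
  f_mono_right : ∀ x y y' : ℝ, x ∈ Set.Icc (0:ℝ) 1 → y ∈ Set.Icc (0:ℝ) 1 →
    y' ∈ Set.Icc (0:ℝ) 1 → x ≠ 0 → y ≠ 0 → y ≤ y' → f x y ≤ f x y'
  f_zero_left : ∀ x ∈ Set.Icc (0:ℝ) 1, f 0 x = 0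
  f_zero_right : ∀ x ∈ Set.Icc (0:ℝ) 1, f x 0 = 0
  f_one_right : ∀ x ∈ Set.Icc (0:ℝ) 1, f x 1 = x
  f_one_left : ∀ x ∈ Set.Icc (0:ℝ) 1, f 1 x = x
  g_nil : g [] = 1
  g_single : ∀ x ∈ Set.Icc (0:ℝ) 1, g [x] = x
  g_zero : ∀ l : List ℝ, (∀ x ∈ l, x ∈ Set.Icc (0:ℝ) 1) → g (l ++ [0]) = 0
  g_one : ∀ l : List ℝ, (∀ x ∈ l, x ∈ Set.Icc (0:ℝ) 1) → g (l ++ [1]) = g l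
  g_mono : ∀ l : List ℝ, (∀ x ∈ l, x ∈ Set.Icc (0:ℝ) 1) →
    ∀ y z : ℝ, y ∈ Set.Icc (0:ℝ) 1 → z ∈ Set.Icc (0:ℝ) 1 → y ≤ z →
      g (l ++ [y]) ≤ g (l ++ [z])

theorem basis_node (r : ℝ) (cs : List T) :
    basis (.node r cs) = r ::ₘ (cs.map basis).sum := by
  rw [basis, List.attach_map_val (f := basis)]

theorem Str_node (f : ℝ → ℝ → ℝ) (g : List ℝ → ℝ) (r : ℝ) (cs : List T) :
    Str f g (.node r cs) = f r (g (cs.map (Str f g))) := by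
  rw [Str, List.attach_map_val (f := Str f g)]

theorem mem_basis_node {b r : ℝ} {cs : List T} :
    b ∈ basis (.node r cs) ↔ b = r ∨ ∃ c ∈ cs, b ∈ basis c := by
  rw [basis_node, Multiset.mem_cons]
  refine or_congr_right ?_
  induction cs <;> simp_all

theorem admissible.of_mem {r : ℝ} {cs : List T} (h : admissible (.node r cs)) {c : T}
    (hc : c ∈ cs) : admissible c :=
  fun b hb => h b (mem_basis_node.2 (.inr ⟨c, hc, hb⟩))

theorem admissible.root_mem {r : ℝ} {cs : List T} (h : admissible (.node r cs)) :
    r ∈ Set.Icc (0 : ℝ) 1 :=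
  h r (mem_basis_node.2 (.inl rfl))

namespace WellBehaved

variable {f : ℝ → ℝ → ℝ} {g : List ℝ → ℝ}

theorem Str_mem (hwb : WellBehaved f g) : ∀ A : T, admissible A → Str f g A ∈ Set.Icc (0 : ℝ) 1
  | .leaf w, hA => by
    rw [Str]
    exact hwb.f_mem w (hA w (by simp [basis])) _ (hwb.g_mem _ (by simp))
  | .node r cs, hA => by
    rw [Str_node]
    refine hwb.f_mem r hA.root_mem _ (hwb.g_mem _ fun x hx => ?_)
    obtain ⟨c, hc, rfl⟩ := List.mem_map.1 hx
    exact hwb.Str_mem c (hA.of_mem hc)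
termination_by A => sizeOf A
decreasing_by
  have := List.sizeOf_lt_of_mem hc
  simp only [T.node.sizeOf_spec]
  omega

theorem g_eq_zero_of_mem (hwb : WellBehaved f g) {l : List ℝ}
    (hl : ∀ x ∈ l, x ∈ Set.Icc (0 : ℝ) 1) (h : (0 : ℝ) ∈ l) : g l = 0 := by
  rw [hwb.g_perm l (l.erase 0 ++ [0])
    ((List.perm_cons_erase h).trans (List.perm_append_singleton _ _).symm)]
  exact hwb.g_zero _ fun x hx => hl x (List.mem_of_mem_erase hx)

theorem Str_eq_zero (hwb : WellBehaved f g) :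
    ∀ A : T, admissible A → (0 : ℝ) ∈ basis A → Str f g A = 0
  | .leaf w, _, h => by
    obtain rfl : 0 = w := by simpa [basis] using h
    rw [Str]
    exact hwb.f_zero_left _ (hwb.g_mem _ (by simp))
  | .node r cs, hA, h => by
    have hl : ∀ x ∈ cs.map (Str f g), x ∈ Set.Icc (0 : ℝ) 1 := fun x hx => by
      obtain ⟨c, hc, rfl⟩ := List.mem_map.1 hx
      exact hwb.Str_mem c (hA.of_mem hc)
    rw [Str_node]
    rcases mem_basis_node.1 h with rfl | ⟨c, hc, h0⟩
    · exact hwb.f_zero_left _ (hwb.g_mem _ hl)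
    · rw [hwb.g_eq_zero_of_mem hl
        (List.mem_map.2 ⟨c, hc, hwb.Str_eq_zero c (hA.of_mem hc) h0⟩)]
      exact hwb.f_zero_right r hA.root_mem
termination_by A => sizeOf A
decreasing_by
  have := List.sizeOf_lt_of_mem hc
  simp only [T.node.sizeOf_spec]
  omega

end WellBehaved

theorem wellBehaved_argument_death (f : ℝ → ℝ → ℝ) (g : List ℝ → ℝ)
    (hwb : WellBehaved f g) (A : T) (hA : admissible A)
    (h : (0:ℝ) ∈ basis A) :
    Str f g A = 0 :=
  hwb.Str_eq_zero A hA h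
end
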